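/- arXiv:2408.15215 — 2 statements merged into one kernel-verified Lean document; each statement's English description precedes it below -/
import Mathlib

section
/- The number of labelled rooted forests on [n] with exactly m components (each component a rooted tree, roots unrestricted) equals C(n−1, m−1) · n^{n−m}. -/
namespace RootedForestCount

open SimpleGraph

variable {V : Type*}

/-- `R` is a set of roots of the forest `G`. -/
def Rooted (G : SimpleGraph V) (R : Set V) : Prop :=
  G.IsAcyclic ∧ (∀ u, ∃ x ∈ R, G.Reachable u x) ∧ ∀ x ∈ R, ∀ y ∈ R, G.Reachable x y → x = y

lemma reach_sup {G : SimpleGraph V} {a b u w : V} (h : (G ⊔ edge a b).Reachable u w) :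
    G.Reachable u w ∨ (G.Reachable u a ∧ G.Reachable b w) ∨
      (G.Reachable u b ∧ G.Reachable a w) := by
  obtain ⟨p⟩ := h
  induction p with
  | nil => exact Or.inl (Reachable.refl _)
  | @cons u v w hadj p ih =>
    rw [sup_adj, edge_adj] at hadj
    rcases hadj with hadj | ⟨⟨rfl, rfl⟩ | ⟨rfl, rfl⟩, _⟩
    · have h1 := hadj.reachable
      rcases ih with h | ⟨h, h'⟩ | ⟨h, h'⟩
      · exact Or.inl (h1.trans h)
      · exact Or.inr (Or.inl ⟨h1.trans h, h'⟩)
      · exact Or.inr (Or.inr ⟨h1.trans h, h'⟩)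
    · rcases ih with h | ⟨h, h'⟩ | ⟨h, h'⟩
      · exact Or.inr (Or.inl ⟨Reachable.refl _, h⟩)
      · exact Or.inr (Or.inl ⟨Reachable.refl _, h'⟩)
      · exact Or.inl h'
    · rcases ih with h | ⟨h, h'⟩ | ⟨h, h'⟩
      · exact Or.inr (Or.inr ⟨Reachable.refl _, h⟩)
      · exact Or.inl h'
      · exact Or.inr (Or.inr ⟨Reachable.refl _, h'⟩)

lemma sup_delete {G : SimpleGraph V} {v r : V} (h : ¬ G.Reachable v r) :
    (G ⊔ edge v r).deleteEdges {s(v, r)} = G := by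
  have h1 : ¬ G.Adj v r := fun h' => h h'.reachable
  have h2 : ¬ G.Adj r v := fun h' => h h'.symm.reachable
  ext a b
  simp only [deleteEdges_adj, sup_adj, edge_adj, Set.mem_singleton_iff, Sym2.eq_iff]
  constructor
  · rintro ⟨h | h, h'⟩
    · exact h
    · exact absurd h.1 h'
  · intro hab
    refine ⟨Or.inl hab, ?_⟩
    rintro (⟨rfl, rfl⟩ | ⟨rfl, rfl⟩)
    · exact h1 hab
    · exact h2 hab

lemma delete_sup {G : SimpleGraph V} {v r : V} (h : G.Adj v r) :
    G.deleteEdges {s(v, r)} ⊔ edge v r = G := by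
  ext a b
  simp only [deleteEdges_adj, sup_adj, edge_adj, Set.mem_singleton_iff, Sym2.eq_iff]
  constructor
  · rintro (h | ⟨⟨rfl, rfl⟩ | ⟨rfl, rfl⟩, h'⟩)
    · exact h.1
    · exact h
    · exact h.symm
  · intro hab
    by_cases hc : a = v ∧ b = r ∨ a = r ∧ b = v
    · exact Or.inr ⟨hc, hab.ne⟩
    · exact Or.inl ⟨hab, hc⟩

lemma bridge {G : SimpleGraph V} (hG : G.IsAcyclic) {v r : V} (h : G.Adj v r) :
    ¬ (G.deleteEdges {s(v, r)}).Reachable v r :=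
  isBridge_iff.1 (isAcyclic_iff_forall_adj_isBridge.1 hG h)

/-- `v` is the parent of `r`. -/
def Par (G : SimpleGraph V) (R : Set V) (v r : V) : Prop :=
  r ∉ R ∧ G.Adj v r ∧ ∀ x ∈ R, ¬ (G.deleteEdges {s(v, r)}).Reachable r x

lemma exists_unique_par {G : SimpleGraph V} {R : Set V} (h : Rooted G R) {r : V} (hr : r ∉ R) :
    ∃! v, Par G R v r := by
  classical
  obtain ⟨hG, hex, huniq⟩ := h
  obtain ⟨x, hx, hrx⟩ := hex r
  obtain ⟨p, hp⟩ := hrx.exists_isPath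
  cases p with
  | nil => exact absurd hx hr
  | @cons _ v _ hadj p =>
    rw [Walk.cons_isPath_iff] at hp
    refine ⟨v, ⟨hr, hadj.symm, ?_⟩, ?_⟩
    · intro y hy hry
      have hxy : y = x := huniq y hy x hx
        ((hry.mono (deleteEdges_le _)).symm.trans hrx)
      subst hxy
      have hv : (G.deleteEdges {s(v, r)}).Reachable v y := by
        rw [reachable_deleteEdges_iff_exists_walk]
        exact ⟨p, fun hmem => hp.2 (p.snd_mem_support_of_mem_edges hmem)⟩
      exact bridge hG hadj.symm (hv.trans hry.symm)
    · rintro w ⟨_, hw, hw'⟩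
      have hm := Walk.mem_edges_of_not_reachable_deleteEdges (Walk.cons hadj p) (hw' x hx)
      rw [Walk.edges_cons, List.mem_cons] at hm
      rcases hm with hm | hm
      · rw [Sym2.eq_iff] at hm
        rcases hm with ⟨h1, h2⟩ | ⟨h1, h2⟩
        · exact h1.trans h2
        · exact h1
      · exact absurd (p.snd_mem_support_of_mem_edges hm) hp.2

lemma forward {G : SimpleGraph V} {R : Set V} (h : Rooted G R) {v r : V} (hr : r ∈ R)
    (hv : ¬ G.Reachable v r) :
    Rooted (G ⊔ edge v r) (R \ {r}) ∧ Par (G ⊔ edge v r) (R \ {r}) v r := by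
  obtain ⟨hG, hex, huniq⟩ := h
  have hle : G ≤ G ⊔ edge v r := le_sup_left
  have hne : v ≠ r := by rintro rfl; exact hv (Reachable.refl _)
  have hadj : (G ⊔ edge v r).Adj v r := by simp [edge_adj, hne]
  refine ⟨⟨hG.sup_edge_of_not_reachable hv, ?_, ?_⟩, by simp, hadj, ?_⟩
  · intro u
    obtain ⟨x, hx, hux⟩ := hex u
    by_cases hxr : x = r
    · subst hxr
      obtain ⟨y, hy, hvy⟩ := hex v
      refine ⟨y, ⟨hy, ?_⟩, ((hux.mono hle).trans hadj.symm.reachable).trans (hvy.mono hle)⟩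
      rintro rfl
      exact hv hvy
    · exact ⟨x, ⟨hx, hxr⟩, hux.mono hle⟩
  · rintro x ⟨hx, hxr⟩ y ⟨hy, hyr⟩ hxy
    rcases reach_sup hxy with h | ⟨_, h⟩ | ⟨h, _⟩
    · exact huniq x hx y hy h
    · exact absurd (huniq r hr y hy h).symm hyr
    · exact absurd (huniq x hx r hr h) hxr
  · rintro x ⟨hx, hxr⟩ h
    rw [sup_delete hv] at h
    exact hxr (huniq r hr x hx h).symm

lemma backward {G : SimpleGraph V} {R : Set V} (h : Rooted G R) {v r : V} (hp : Par G R v r) :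
    Rooted (G.deleteEdges {s(v, r)}) (insert r R) ∧
      ¬ (G.deleteEdges {s(v, r)}).Reachable v r := by
  obtain ⟨hG, hex, huniq⟩ := h
  obtain ⟨hr, hadj, hp⟩ := hp
  have hle : G.deleteEdges {s(v, r)} ≤ G := deleteEdges_le _
  refine ⟨⟨hG.anti hle, ?_, ?_⟩, bridge hG hadj⟩
  · intro u
    obtain ⟨x, hx, hux⟩ := hex u
    rw [← delete_sup hadj] at hux
    rcases reach_sup hux with h | ⟨_, h⟩ | ⟨h, _⟩
    · exact ⟨x, Or.inr hx, h⟩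
    · exact absurd h (hp x hx)
    · exact ⟨r, Or.inl rfl, h⟩
  · rintro x (rfl | hx) y (rfl | hy) hxy
    · rfl
    · exact absurd hxy (hp y hy)
    · exact absurd hxy.symm (hp x hx)
    · exact huniq x hx y hy (hxy.mono hle)

/-- Rooted forests with `m` roots. -/
abbrev X (V : Type*) (m : ℕ) : Type _ :=
  {p : SimpleGraph V × Set V // Rooted p.1 p.2 ∧ p.2.ncard = m}

lemma left_ext {m : ℕ}
    {a b : Σ x : X V m, Σ v : V, {r : V // r ∈ x.1.2 ∧ ¬ x.1.1.Reachable v r}}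
    (h1 : a.1.1 = b.1.1) (h2 : a.2.1 = b.2.1) (h3 : a.2.2.1 = b.2.2.1) : a = b := by
  obtain ⟨⟨p, hp⟩, v, ⟨r, hr⟩⟩ := a
  obtain ⟨⟨p', hp'⟩, v', ⟨r', hr'⟩⟩ := b
  simp only at h1 h2 h3
  subst h1 h2 h3
  rfl

lemma right_ext {m : ℕ}
    {a b : Σ x : X V m, {q : V × V // Par x.1.1 x.1.2 q.1 q.2}}
    (h1 : a.1.1 = b.1.1) (h2 : a.2.1 = b.2.1) : a = b := by
  obtain ⟨⟨p, hp⟩, ⟨q, hq⟩⟩ := a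
  obtain ⟨⟨p', hp'⟩, ⟨q', hq'⟩⟩ := b
  simp only at h1 h2
  subst h1 h2
  rfl

/-- The double counting bijection. -/
noncomputable def corr [Finite V] (m : ℕ) :
    (Σ x : X V (m + 1), Σ v : V, {r : V // r ∈ x.1.2 ∧ ¬ x.1.1.Reachable v r}) ≃
    (Σ x : X V m, {q : V × V // Par x.1.1 x.1.2 q.1 q.2}) where
  toFun a := ⟨⟨(a.1.1.1 ⊔ edge a.2.1 a.2.2.1, a.1.1.2 \ {a.2.2.1}),
      (forward a.1.2.1 a.2.2.2.1 a.2.2.2.2).1, by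
        have := Set.ncard_sdiff_singleton_add_one a.2.2.2.1 (Set.toFinite _)
        have h2 := a.1.2.2
        simp only at *
        omega⟩,
    ⟨(a.2.1, a.2.2.1), (forward a.1.2.1 a.2.2.2.1 a.2.2.2.2).2⟩⟩
  invFun b := ⟨⟨(b.1.1.1.deleteEdges {s(b.2.1.1, b.2.1.2)}, insert b.2.1.2 b.1.1.2),
      (backward b.1.2.1 b.2.2).1, by
        have := Set.ncard_insert_of_notMem b.2.2.1 (Set.toFinite _)
        have h2 := b.1.2.2
        simp only at *
        omega⟩,
    ⟨b.2.1.1, ⟨b.2.1.2, Or.inl rfl, (backward b.1.2.1 b.2.2).2⟩⟩⟩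
  left_inv := by
    rintro ⟨⟨⟨G, R⟩, hR, hm⟩, v, ⟨r, hr, hv⟩⟩
    refine left_ext (Prod.ext (sup_delete hv) ?_) rfl rfl
    change insert r (R \ {r}) = R
    simp [Set.insert_eq_of_mem hr]
  right_inv := by
    rintro ⟨⟨⟨G, R⟩, hR, hm⟩, ⟨⟨v, r⟩, hp⟩⟩
    refine right_ext (Prod.ext (delete_sup hp.2.1) ?_) rfl
    change insert r R \ {r} = R
    exact Set.insert_sdiff_self_of_notMem hp.1

lemma card_left [Fintype V] (m : ℕ) (x : X V (m + 1)) :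
    Nat.card (Σ v : V, {r : V // r ∈ x.1.2 ∧ ¬ x.1.1.Reachable v r}) = Fintype.card V * m := by
  obtain ⟨⟨G, R⟩, ⟨hG, hex, huniq⟩, hm⟩ := x
  rw [Nat.card_sigma, Finset.sum_const_nat (m := m), Finset.card_univ]
  intro v _
  obtain ⟨x, hx, hvx⟩ := hex v
  have : {r : V | r ∈ R ∧ ¬ G.Reachable v r} = R \ {x} := by
    ext r
    simp only [Set.mem_ofPred_eq, Set.mem_sdiff, Set.mem_singleton_iff]
    refine and_congr_right fun hr => not_congr ⟨fun h => ?_, ?_⟩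
    · exact huniq r hr x hx (h.symm.trans hvx)
    · rintro rfl; exact hvx
  change Nat.card ({r : V | r ∈ R ∧ ¬ G.Reachable v r} : Set V) = m
  rw [this, Nat.card_coe_set_eq]
  have := Set.ncard_sdiff_singleton_add_one hx (Set.toFinite _)
  simp only at hm hx this
  omega

lemma card_right [Fintype V] (m : ℕ) (x : X V m) :
    Nat.card {q : V × V // Par x.1.1 x.1.2 q.1 q.2} = Fintype.card V - m := by
  obtain ⟨⟨G, R⟩, hR, hm⟩ := x
  simp only at *
  have : Nat.card {q : V × V // Par G R q.1 q.2} = Nat.card (Rᶜ : Set V) := by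
    refine Nat.card_congr (Equiv.ofBijective (fun q => ⟨q.1.2, q.2.1⟩) ⟨?_, ?_⟩)
    · rintro ⟨⟨v, r⟩, h⟩ ⟨⟨v', r'⟩, h'⟩ he
      simp only [Subtype.mk.injEq] at he
      subst he
      have := (exists_unique_par hR h.1).unique h h'
      simp only at this
      subst this
      rfl
    · rintro ⟨r, hr⟩
      obtain ⟨v, hv, _⟩ := exists_unique_par hR hr
      exact ⟨⟨(v, r), hv⟩, rfl⟩
  rw [this, Nat.card_coe_set_eq, Set.ncard_compl, hm, Nat.card_eq_fintype_card]

lemma recur [Fintype V] (m : ℕ) :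
    Nat.card (X V (m + 1)) * (Fintype.card V * m) = Nat.card (X V m) * (Fintype.card V - m) := by
  classical
  have hc := Nat.card_congr (corr (V := V) m)
  have := Fintype.ofFinite (X V (m + 1))
  have := Fintype.ofFinite (X V m)
  rw [Nat.card_sigma, Nat.card_sigma] at hc
  simp only [card_left, card_right] at hc
  simpa [Finset.sum_const] using hc

lemma base [Fintype V] : Nat.card (X V (Fintype.card V)) = 1 := by
  rw [Nat.card_eq_one_iff_unique]
  refine ⟨⟨?_⟩, ⟨⟨(⊥, Set.univ), ⟨isAcyclic_bot, fun u => ⟨u, trivial, Reachable.refl _⟩, ?_⟩, ?_⟩⟩⟩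
  · have key : ∀ x : X V (Fintype.card V), x.1 = (⊥, Set.univ) := by
      rintro ⟨⟨G, R⟩, ⟨_, _, hu⟩, hm⟩
      simp only at *
      have hR : R = Set.univ := by
        rw [← Nat.card_eq_fintype_card] at hm
        exact (Set.eq_univ_iff_ncard R).2 hm
      subst hR
      refine Prod.ext ?_ rfl
      ext a b
      simp only [bot_adj, iff_false]
      exact fun h => h.ne (hu a trivial b trivial h.reachable)
    exact fun x y => Subtype.ext ((key x).trans (key y).symm)
  · intro x _ y _ h
    simpa using h
  · simp [Set.ncard_univ]

lemma main [Fintype V] (k m : ℕ) (hm : 1 ≤ m) (h : m + k = Fintype.card V) :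
    Nat.card (X V m) = Nat.choose (Fintype.card V - 1) (m - 1) * Fintype.card V ^ k := by
  induction k generalizing m with
  | zero =>
    obtain rfl : m = Fintype.card V := by omega
    simp [base]
  | succ k ih =>
    have h1 := ih (m + 1) (by omega) (by omega)
    have h2 := recur (V := V) m
    obtain ⟨j, rfl⟩ : ∃ j, m = j + 1 := ⟨m - 1, by omega⟩
    rw [h1] at h2
    generalize Fintype.card V = N at *
    have e : N - (j + 1) = k + 1 := by omega
    have h3 := Nat.choose_succ_right_eq (N - 1) j
    have e' : N - 1 - j = k + 1 := by omega
    rw [e] at h2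
    rw [e'] at h3
    simp only [Nat.add_sub_cancel] at *
    have : Nat.card (X V (j + 1)) * (k + 1) = (N - 1).choose j * N ^ (k + 1) * (k + 1) := by
      rw [← h2, pow_succ]
      linear_combination N ^ k * N * h3
    exact Nat.eq_of_mul_eq_mul_right (by omega) this

lemma cond_iff [Finite V] (G : SimpleGraph V) (R : Set V) (m : ℕ) :
    (G.IsAcyclic ∧ Nat.card G.ConnectedComponent = m ∧
      ∀ c : G.ConnectedComponent, ∃! v : V, v ∈ R ∧ G.connectedComponentMk v = c) ↔
    Rooted G R ∧ R.ncard = m := by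
  have key : (∀ c : G.ConnectedComponent, ∃! v : V, v ∈ R ∧ G.connectedComponentMk v = c) →
      R.ncard = Nat.card G.ConnectedComponent := by
    intro h
    rw [← Nat.card_coe_set_eq]
    refine Nat.card_congr (Equiv.ofBijective (fun v : R => G.connectedComponentMk v) ⟨?_, ?_⟩)
    · intro a b hab
      exact Subtype.ext ((h _).unique ⟨a.2, hab⟩ ⟨b.2, rfl⟩)
    · intro c
      obtain ⟨v, ⟨hv, hc⟩, _⟩ := h c
      exact ⟨⟨v, hv⟩, hc⟩
  have key2 : (∀ c : G.ConnectedComponent, ∃! v : V, v ∈ R ∧ G.connectedComponentMk v = c) ↔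
      (∀ u, ∃ x ∈ R, G.Reachable u x) ∧ ∀ x ∈ R, ∀ y ∈ R, G.Reachable x y → x = y := by
    constructor
    · intro h
      refine ⟨fun u => ?_, fun x hx y hy hxy => ?_⟩
      · obtain ⟨v, ⟨hv, hc⟩, _⟩ := h (G.connectedComponentMk u)
        exact ⟨v, hv, (ConnectedComponent.eq.1 hc).symm⟩
      · exact (h (G.connectedComponentMk y)).unique ⟨hx, ConnectedComponent.eq.2 hxy⟩ ⟨hy, rfl⟩
    · rintro ⟨h1, h2⟩ c
      induction c using ConnectedComponent.ind with | _ u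
      obtain ⟨x, hx, hux⟩ := h1 u
      refine ⟨x, ⟨hx, ConnectedComponent.eq.2 hux.symm⟩, ?_⟩
      rintro y ⟨hy, hyc⟩
      exact h2 y hy x hx ((ConnectedComponent.eq.1 hyc).trans hux)
  unfold Rooted
  rw [← key2]
  constructor
  · rintro ⟨a, b, c⟩
    exact ⟨⟨a, c⟩, (key c).trans b⟩
  · rintro ⟨⟨a, c⟩, b⟩
    exact ⟨a, (key c).symm.trans b, c⟩

end RootedForestCount


/-- The number of labelled rooted forests on `[n]` with exactly `m` components
(each component having one distinguished root) equals `C(n−1, m−1)·n^{n−m}`.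
A rooted forest is encoded as a pair `(G, R)` of an acyclic graph `G` and a set
`R` of roots containing exactly one vertex from each connected component. -/
theorem count_rooted_forests (n m : ℕ) (hn : 1 ≤ n) (hm : 1 ≤ m) (hmn : m ≤ n) :
    Nat.card {p : SimpleGraph (Fin n) × Set (Fin n) //
        p.1.IsAcyclic ∧ Nat.card p.1.ConnectedComponent = m ∧
        ∀ c : p.1.ConnectedComponent,
          ∃! v : Fin n, v ∈ p.2 ∧ p.1.connectedComponentMk v = c}
      = Nat.choose (n - 1) (m - 1) * n ^ (n - m) := by
  simp only [RootedForestCount.cond_iff]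
  have := RootedForestCount.main (V := Fin n) (n - m) m hm (by simp; omega)
  rw [Fintype.card_fin] at this
  exact this
end

section
/- For integers n ≥ 2, Δ ≥ 3 and 1 ≤ m ≤ n−1, the number f_Δ(n,m) of labelled rooted forests on [n] with maximum degree at most Δ, exactly m components, and every root having degree at most Δ−1, satisfies f_Δ(n,m) = ((n−1)!/(m−1)!) · [x^n] x^m (γ_Δ(x))^n, where γ_Δ(x) = Σ_{k=0}^{Δ-1} x^k/k!. -/
open Polynomial

/-- The polynomial `γ_Δ(x) = ∑_{k=0}^{Δ-1} x^k / k!` over `ℚ`. -/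
noncomputable def gamPoly (Δ : ℕ) : Polynomial ℚ :=
  ∑ k ∈ Finset.range Δ, Polynomial.C ((Nat.factorial k : ℚ)⁻¹) * Polynomial.X ^ k

section Forests

open Finset
set_option linter.unusedSectionVars false
variable {V : Type*} [Fintype V] [DecidableEq V]

/-- `f` is acyclic on `A`: there is a rank function strictly decreasing along `f`. -/
def AcycOn (A : Finset V) (f : V → V) : Prop := ∃ h : V → ℕ, ∀ v ∈ A, h (f v) < h v

/-- functions mapping `A` into `C` and fixing everything else -/
def PF (A C : Finset V) : Finset (V → V) := Fintype.piFinset (fun v => if v ∈ A then C else {v})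

lemma mem_PF {A C : Finset V} {f : V → V} :
    f ∈ PF A C ↔ (∀ v ∈ A, f v ∈ C) ∧ ∀ v ∉ A, f v = v := by
  simp only [PF, Fintype.mem_piFinset]
  constructor
  · intro h
    refine ⟨fun v hv => by simpa [hv] using h v, fun v hv => by simpa [hv] using h v⟩
  · rintro ⟨h1, h2⟩ v
    by_cases hv : v ∈ A
    · simpa [hv] using h1 v hv
    · simpa [hv] using h2 v hv

open Classical in
noncomputable def FW {R : Type*} [CommRing R] (x : V → R) (A B : Finset V) : R :=
  ∑ f ∈ (PF A (A ∪ B)).filter (fun f => AcycOn A f), ∏ v ∈ A, x (f v)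

lemma sum_PF {R : Type*} [CommRing R] (x : V → R) (S B : Finset V) :
    ∑ f ∈ PF S B, ∏ v ∈ S, x (f v) = (∑ b ∈ B, x b) ^ S.card := by
  have h := Finset.prod_univ_sum (fun v => if v ∈ S then B else {v})
    (fun v b => if v ∈ S then x b else 1)
  have h1 : ∀ v, (∑ b ∈ (if v ∈ S then B else {v}), if v ∈ S then x b else 1)
      = if v ∈ S then (∑ b ∈ B, x b) else 1 := by
    intro v; split_ifs <;> simp
  simp only [h1] at h
  rw [Finset.prod_ite_mem] at h
  simp only [univ_inter, prod_const] at h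
  rw [h]
  refine Finset.sum_congr rfl fun f _ => ?_
  rw [Finset.prod_ite_mem]; simp

lemma FW_empty {R : Type*} [CommRing R] (x : V → R) (B : Finset V) : FW x ∅ B = 1 := by
  classical
  have : ((PF (∅ : Finset V) (∅ ∪ B)).filter (fun f => AcycOn ∅ f)) = {id} := by
    ext f
    simp only [mem_filter, mem_PF, mem_singleton]
    constructor
    · rintro ⟨⟨-, h⟩, -⟩; funext v; exact h v (by simp)
    · rintro rfl; exact ⟨⟨by simp, by simp⟩, ⟨fun _ => 0, by simp⟩⟩
  unfold FW
  rw [this]; simp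

lemma FW_noroot {R : Type*} [CommRing R] (x : V → R) (A : Finset V) (hA : A.Nonempty) :
    FW x A ∅ = 0 := by
  unfold FW
  classical
  rw [Finset.filter_eq_empty_iff.2, Finset.sum_empty]
  rintro f hf ⟨h, hh⟩
  obtain ⟨a, ha, hmin⟩ := Finset.exists_min_image A h hA
  have h1 := (mem_PF.1 hf).1 a ha
  simp only [union_empty] at h1
  exact absurd (hh a ha) (not_lt.2 (hmin _ h1))

lemma FW_rec {R : Type*} [CommRing R] (x : V → R) (A B : Finset V) (hAB : Disjoint A B) :
    FW x A B = ∑ S ∈ A.powerset, (∑ b ∈ B, x b) ^ S.card * FW x (A \ S) S := by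
  classical
  unfold FW
  rw [← Finset.sum_fiberwise_of_maps_to (t := A.powerset) (g := fun f => A.filter (fun v => f v ∈ B))]
  swap
  · intro f _; simp
  refine Finset.sum_congr rfl fun S hS => ?_
  rw [mem_powerset] at hS
  rw [← sum_PF, Finset.sum_mul_sum, ← Finset.sum_product']
  rw [Finset.sdiff_union_of_subset hS]
  have hd := Finset.disjoint_left.1 hAB
  refine Finset.sum_bij' (fun f _ => (S.piecewise f id, (A \ S).piecewise f id))
    (fun p _ => S.piecewise p.1 p.2) ?_ ?_ ?_ ?_ ?_
  · intro f hf
    simp only [mem_filter, mem_PF, mem_product] at hf ⊢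
    obtain ⟨⟨⟨h1, h2⟩, r, hr⟩, h3⟩ := hf
    have h3' : ∀ v, v ∈ S ↔ v ∈ A ∧ f v ∈ B := by intro v; rw [← h3]; simp
    refine ⟨⟨fun v hv => ?_, fun v hv => ?_⟩, ⟨fun v hv => ?_, fun v hv => ?_⟩, r, fun v hv => ?_⟩
    · simp only [Finset.piecewise, hv, if_true]; exact ((h3' v).1 hv).2
    · simp [Finset.piecewise, hv]
    · simp only [Finset.piecewise, hv, if_true]
      rw [mem_sdiff, h3'] at hv
      have := h1 v hv.1
      rw [mem_union] at this
      tauto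
    · simp only [Finset.piecewise, hv, if_false, id]
    · simp only [Finset.piecewise, hv, if_true]
      exact hr v (mem_sdiff.1 hv).1
  · rintro ⟨g, k⟩ hp
    simp only [mem_filter, mem_PF, mem_product] at hp ⊢
    obtain ⟨⟨h1, h2⟩, ⟨h3, h4⟩, r, hr⟩ := hp
    refine ⟨⟨⟨fun v hv => ?_, fun v hv => ?_⟩, fun v => if v ∈ A then r v + 1 else 0, fun v hv => ?_⟩, ?_⟩
    · by_cases hs : v ∈ S
      · simp only [Finset.piecewise, hs, if_true]; exact mem_union_right _ (h1 v hs)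
      · simp only [Finset.piecewise, hs, if_false]
        exact mem_union_left _ (h3 v (mem_sdiff.2 ⟨hv, hs⟩))
    · have hs : v ∉ S := fun h => hv (hS h)
      simp only [Finset.piecewise, hs, if_false]
      exact h4 v (by simp [hv])
    · by_cases hs : v ∈ S
      · have : g v ∉ A := fun h => hd h (h1 v hs)
        simp [Finset.piecewise, hs, this, hv]
      · have h5 := mem_sdiff.2 ⟨hv, hs⟩
        have h6 := hr v h5
        have h7 := h3 v h5
        simp [Finset.piecewise, hs, h7, hv, h6]
    · ext v
      simp only [mem_filter]
      by_cases hs : v ∈ S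
      · simp [Finset.piecewise, hs, hS hs, h1 v hs]
      · simp only [Finset.piecewise, hs, if_false, iff_false]
        rintro ⟨ha, hb⟩
        exact hd (h3 v (mem_sdiff.2 ⟨ha, hs⟩)) hb
  · intro f hf
    simp only [mem_filter, mem_PF] at hf
    funext v
    by_cases hs : v ∈ S
    · simp [Finset.piecewise, hs]
    · by_cases ha : v ∈ A
      · simp [Finset.piecewise, hs, ha]
      · simp [Finset.piecewise, hs, ha, hf.1.1.2 v ha]
  · rintro ⟨g, k⟩ hp
    simp only [mem_filter, mem_PF, mem_product] at hp
    obtain ⟨⟨h1, h2⟩, ⟨h3, h4⟩, -⟩ := hp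
    refine Prod.ext ?_ ?_
    · funext v
      by_cases hs : v ∈ S
      · simp [Finset.piecewise, hs]
      · simp [Finset.piecewise, hs, h2 v hs]
    · funext v
      by_cases hs : v ∈ A \ S
      · simp only [Finset.piecewise, hs, if_true, (mem_sdiff.1 hs).2, if_false]
      · simp only [Finset.piecewise, hs, if_false, h4 v hs, id]
  · intro f hf
    simp only
    rw [← Finset.prod_sdiff hS, mul_comm]
    congr 1
    · exact Finset.prod_congr rfl fun v hv => by simp [Finset.piecewise, hv]
    · exact Finset.prod_congr rfl fun v hv => by simp only [Finset.piecewise, hv, if_true]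

lemma sum_powerset_weighted {R : Type*} [CommRing R] (x : V → R) (A : Finset V) (y z : R) :
    ∑ S ∈ A.powerset, y ^ S.card * ((∑ s ∈ S, x s) * z ^ (A.card - S.card))
      = (∑ a ∈ A, x a) * (y * (y + z) ^ (A.card - 1)) := by
  have h1 : ∀ S ∈ A.powerset, y ^ S.card * ((∑ s ∈ S, x s) * z ^ (A.card - S.card))
      = ∑ a ∈ A, if a ∈ S then x a * (y ^ S.card * z ^ (A.card - S.card)) else 0 := by
    intro S hS
    rw [Finset.sum_ite_mem, Finset.inter_eq_right.2 (mem_powerset.1 hS), ← Finset.sum_mul]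
    ring
  rw [Finset.sum_congr rfl h1, Finset.sum_comm, Finset.sum_mul]
  refine Finset.sum_congr rfl fun a ha => ?_
  rw [← Finset.card_erase_of_mem ha, ← Finset.sum_pow_mul_eq_add_pow, Finset.mul_sum,
    Finset.mul_sum, ← Finset.sum_filter]
  refine Finset.sum_bij' (fun S _ => S.erase a) (fun S _ => insert a S) ?_ ?_ ?_ ?_ ?_
  · intro S hS
    simp only [mem_filter, mem_powerset] at hS ⊢
    exact Finset.erase_subset_erase _ hS.1
  · intro S hS
    simp only [mem_filter, mem_powerset] at hS ⊢
    exact ⟨Finset.insert_subset ha (hS.trans (erase_subset _ _)), mem_insert_self _ _⟩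
  · intro S hS
    exact Finset.insert_erase (mem_filter.1 hS).2
  · intro S hS
    exact Finset.erase_insert fun h => by simpa using mem_powerset.1 hS h
  · intro S hS
    simp only [mem_filter, mem_powerset] at hS
    have h2 := Finset.card_erase_add_one hS.2
    have h3 := Finset.card_erase_add_one ha
    have h4 : A.card - S.card = (A.erase a).card - (S.erase a).card := by omega
    rw [h4, ← h2]; ring

lemma FW_formula {R : Type*} [CommRing R] [IsDomain R] (x : V → R)
    (hx : ∀ A : Finset V, A.Nonempty → ∑ a ∈ A, x a ≠ 0) (A : Finset V) :
    ∀ B : Finset V, Disjoint A B → A.Nonempty →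
      FW x A B = (∑ b ∈ B, x b) * (∑ a ∈ A ∪ B, x a) ^ (A.card - 1) := by
  induction A using Finset.strongInduction with
  | H A ih =>
  intro B hAB hA
  apply mul_left_cancel₀ (hx A hA)
  rw [FW_rec x A B hAB, Finset.sum_union hAB, add_comm (∑ a ∈ A, x a), ← sum_powerset_weighted,
    Finset.mul_sum]
  refine Finset.sum_congr rfl fun S hS => ?_
  rw [mem_powerset] at hS
  rcases S.eq_empty_or_nonempty with rfl | hne
  · simp [FW_noroot x A hA]
  rcases (A \ S).eq_empty_or_nonempty with he | hne2
  · have : A = S := subset_antisymm (Finset.sdiff_eq_empty_iff_subset.1 he) hS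
    subst this
    simp [FW_empty]; ring
  · rw [ih (A \ S) (Finset.sdiff_ssubset hS hne) S Finset.sdiff_disjoint hne2,
      Finset.sdiff_union_of_subset hS, Finset.card_sdiff_of_subset hS]
    have : 0 < (A \ S).card := hne2.card_pos
    rw [Finset.card_sdiff_of_subset hS] at this
    obtain ⟨k, hk⟩ : ∃ k, A.card - S.card = k + 1 := ⟨A.card - S.card - 1, by omega⟩
    rw [hk]; simp only [add_tsub_cancel_right]; ring

/-- `f` is a parent function of a rooted forest (roots are the fixed points). -/
def Acyc (f : V → V) : Prop := ∃ h : V → ℕ, ∀ v, f v ≠ v → h (f v) < h v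

/-- fixed points -/
def fx (f : V → V) : Finset V := univ.filter (fun v => f v = v)

/-- number of children -/
def kids (f : V → V) (u : V) : ℕ := ((fx f)ᶜ.filter (fun v => f v = u)).card

lemma card_powersetCard_mem (r : V) (m : ℕ) (hm : 1 ≤ m) :
    (((univ : Finset V).powersetCard m).filter (fun R => r ∈ R)).card
      = (Fintype.card V - 1).choose (m - 1) := by
  have h : (univ.erase r : Finset V).card = Fintype.card V - 1 := by
    rw [Finset.card_erase_of_mem (mem_univ r), Finset.card_univ]
  rw [← h, ← Finset.card_powersetCard]
  refine Finset.card_bij' (fun S _ => S.erase r) (fun S _ => insert r S) ?_ ?_ ?_ ?_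
  · intro S hS
    simp only [mem_filter, mem_powersetCard] at hS ⊢
    exact ⟨Finset.erase_subset_erase _ hS.1.1, by rw [Finset.card_erase_of_mem hS.2, hS.1.2]⟩
  · intro S hS
    simp only [mem_filter, mem_powersetCard] at hS ⊢
    have : r ∉ S := fun h => by simpa using hS.1 h
    exact ⟨⟨subset_univ _, by rw [Finset.card_insert_of_notMem this, hS.2]; omega⟩,
      mem_insert_self _ _⟩
  · intro S hS
    exact Finset.insert_erase (mem_filter.1 hS).2
  · intro S hS
    exact Finset.erase_insert fun h => by simpa using (mem_powersetCard.1 hS).1 h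

open Classical in
lemma total_formula {R : Type*} [CommRing R] [IsDomain R] (x : V → R)
    (hx : ∀ A : Finset V, A.Nonempty → ∑ a ∈ A, x a ≠ 0) (m : ℕ) (hm : 1 ≤ m)
    (hm2 : m < Fintype.card V) :
    ∑ f ∈ (univ : Finset (V → V)).filter (fun f => Acyc f ∧ (fx f).card = m),
      ∏ v ∈ (fx f)ᶜ, x (f v)
    = ((Fintype.card V - 1).choose (m - 1) : R) * (∑ a, x a) ^ (Fintype.card V - m) := by
  rw [← Finset.sum_fiberwise_of_maps_to (t := powersetCard m univ) (g := fx)]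
  swap
  · intro f hf; simp only [mem_filter, mem_univ, true_and] at hf; simp [mem_powersetCard, hf.2]
  have key : ∀ S ∈ powersetCard m (univ : Finset V),
      ∑ f ∈ ((univ : Finset (V → V)).filter (fun f => Acyc f ∧ (fx f).card = m)).filter
        (fun f => fx f = S), ∏ v ∈ (fx f)ᶜ, x (f v)
      = (∑ b ∈ S, x b) * (∑ a, x a) ^ (Fintype.card V - m - 1) := by
    intro S hS
    rw [mem_powersetCard] at hS
    have hc : Sᶜ.card = Fintype.card V - m := by rw [Finset.card_compl, hS.2]
    have h := FW_formula x hx Sᶜ S disjoint_compl_left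
      (Finset.card_pos.1 (by omega))
    rw [hc, Finset.union_comm, Finset.union_compl] at h
    rw [← h]
    unfold FW
    refine Finset.sum_congr ?_ ?_
    · ext f
      simp only [mem_filter, mem_univ, true_and, mem_PF, Finset.mem_compl, not_not]
      constructor
      · rintro ⟨⟨⟨rk, hh⟩, h1⟩, rfl⟩
        refine ⟨⟨?_, ?_⟩, rk, ?_⟩
        · intro v _; simp only [mem_union, mem_compl]; tauto
        · intro v hv; simpa [fx] using hv
        · intro v hv; exact hh v (by simpa [fx] using hv)
      · rintro ⟨⟨-, h2⟩, h, hh⟩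
        have : fx f = S := by
          ext v
          simp only [fx, mem_filter, mem_univ, true_and]
          refine ⟨fun hv => ?_, h2 v⟩
          by_contra hS
          have := hh v (by simpa using hS)
          rw [hv] at this; exact lt_irrefl _ this
        refine ⟨⟨⟨h, fun v hv => hh v ?_⟩, by rw [this, hS.2]⟩, this⟩
        rw [mem_compl]; exact fun h => hv (h2 v h)
    · intro f hf
      obtain rfl : fx f = S := by
        simp only [mem_filter, mem_PF] at hf
        obtain ⟨⟨-, h2⟩, h, hh⟩ := hf
        ext v
        simp only [fx, mem_filter, mem_univ, true_and]
        refine ⟨fun hv => ?_, fun hv => h2 v (by simpa using hv)⟩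
        by_contra hS
        have := hh v (by simpa using hS)
        rw [hv] at this; exact lt_irrefl _ this
      rfl
  rw [Finset.sum_congr rfl key, ← Finset.sum_mul]
  have h2 : ∑ S ∈ powersetCard m (univ : Finset V), ∑ b ∈ S, x b
      = ((Fintype.card V - 1).choose (m - 1) : R) * ∑ a, x a := by
    have : ∀ S ∈ powersetCard m (univ : Finset V), ∑ b ∈ S, x b
        = ∑ b, if b ∈ S then x b else 0 := by intro S _; simp
    rw [Finset.sum_congr rfl this, Finset.sum_comm, Finset.mul_sum]
    refine Finset.sum_congr rfl fun r _ => ?_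
    rw [← Finset.sum_filter, Finset.sum_const, card_powersetCard_mem r m hm, nsmul_eq_mul]
  rw [h2, mul_assoc, ← pow_succ']
  congr 2; omega

open Classical in
lemma card_functions (Δ m : ℕ) (hm : 1 ≤ m) (hm2 : m < Fintype.card V) :
    (((univ : Finset (V → V)).filter
      (fun f => (Acyc f ∧ (fx f).card = m) ∧ ∀ v, kids f v < Δ)).card : ℚ)
    = ((Fintype.card V - 1).choose (m - 1) : ℚ) *
      ∑ c ∈ (piAntidiag (univ : Finset V) (Fintype.card V - m)).filter (fun c => ∀ v, c v < Δ),
        (Nat.multinomial univ c : ℚ) := by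
  have hx : ∀ A : Finset V, A.Nonempty → ∑ a ∈ A, (MvPolynomial.X a : MvPolynomial V ℚ) ≠ 0 := by
    intro A hA h
    have := congrArg (MvPolynomial.eval (fun _ => (1 : ℚ))) h
    simp at this
    exact hA.ne_empty this
  have h := total_formula (fun v => (MvPolynomial.X v : MvPolynomial V ℚ)) hx m hm hm2
  have hk : ∀ f : V → V, ∏ v ∈ (fx f)ᶜ, (MvPolynomial.X (f v) : MvPolynomial V ℚ)
      = ∏ u, MvPolynomial.X u ^ kids f u := by
    intro f
    rw [← Finset.prod_fiberwise_of_maps_to (t := univ) (g := f) (by simp)]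
    refine Finset.prod_congr rfl fun u _ => ?_
    rw [Finset.prod_congr rfl (g := fun _ => (MvPolynomial.X u : MvPolynomial V ℚ)), Finset.prod_const]
    · rfl
    · intro v hv; rw [(mem_filter.1 hv).2]
  have hks : ∀ f : V → V, (fx f).card = m → ∑ u, kids f u = Fintype.card V - m := by
    intro f hf
    rw [← hf, ← Finset.card_compl, Finset.card_eq_sum_card_fiberwise (t := univ) (f := f) (by simp)]
    rfl
  simp only [hk] at h
  rw [Finset.sum_pow_eq_sum_piAntidiag] at h
  have hco : ∀ c d : V → ℕ, MvPolynomial.coeff (Finsupp.equivFunOnFinite.symm c)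
      (∏ u, (MvPolynomial.X u : MvPolynomial V ℚ) ^ d u) = if c = d then 1 else 0 := by
    intro c d
    rw [MvPolynomial.coeff_prod_X_pow]
    congr 1
    simp [Finsupp.ext_iff, funext_iff, Finsupp.indicator]
  set T := (piAntidiag (univ : Finset V) (Fintype.card V - m)).filter (fun c => ∀ v, c v < Δ) with hT
  have h2 := congrArg (fun p => ∑ c ∈ T, MvPolynomial.coeff (Finsupp.equivFunOnFinite.symm c) p) h
  simp only [MvPolynomial.coeff_sum, hco] at h2
  rw [Finset.sum_comm] at h2
  have hn1 : ∀ (a : ℕ) (p : MvPolynomial V ℚ) c, MvPolynomial.coeff c ((a : MvPolynomial V ℚ) * p)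
      = a * MvPolynomial.coeff c p := by
    intro a p c; rw [← MvPolynomial.C_eq_coe_nat, MvPolynomial.coeff_C_mul]
  simp only [hn1, MvPolynomial.coeff_sum, hco, Finset.sum_ite_eq'] at h2
  rw [← Finset.filter_filter, Finset.card_filter, Nat.cast_sum]
  rw [Finset.mul_sum]
  convert h2 using 1
  · refine Finset.sum_congr rfl fun f hf => ?_
    have hf' := (mem_filter.1 hf).2.2
    have : kids f ∈ T ↔ ∀ v, kids f v < Δ := by
      rw [hT, mem_filter, mem_piAntidiag]
      simp [hks f hf']
    simp [this]
  · refine Finset.sum_congr rfl fun c hc => ?_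
    simp [(mem_filter.1 hc).1]

lemma coeff_gam (Δ k N : ℕ) (hV : Fintype.card V = N) :
    (gamPoly Δ ^ N).coeff k * (k.factorial : ℚ)
      = ∑ c ∈ (piAntidiag (univ : Finset V) k).filter (fun c => ∀ v, c v < Δ),
        (Nat.multinomial univ c : ℚ) := by
  have h := Finset.prod_univ_sum (fun _ : V => Finset.range Δ)
    (fun _ j => (Polynomial.C ((Nat.factorial j : ℚ)⁻¹) * Polynomial.X ^ j : Polynomial ℚ))
  rw [Finset.prod_const, Finset.card_univ, hV] at h
  unfold gamPoly
  rw [h, Polynomial.finsetSum_coeff, Finset.sum_mul]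
  have : ∀ c ∈ Fintype.piFinset (fun _ : V => Finset.range Δ),
      (∏ v, (Polynomial.C ((Nat.factorial (c v) : ℚ)⁻¹) * Polynomial.X ^ (c v) : Polynomial ℚ)).coeff k
        * (k.factorial : ℚ)
      = if ∑ v, c v = k then (Nat.multinomial univ c : ℚ) else 0 := by
    intro c _
    rw [Finset.prod_mul_distrib, Finset.prod_pow_eq_pow_sum, ← map_prod,
      Polynomial.coeff_C_mul_X_pow]
    by_cases hk : ∑ v, c v = k
    · rw [if_pos hk.symm, if_pos hk, ← hk, ← Nat.multinomial_spec, Nat.cast_mul, Nat.cast_prod,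
        Finset.prod_inv_distrib, inv_mul_cancel_left₀]
      exact Finset.prod_ne_zero_iff.2 fun v _ => by positivity
    · rw [if_neg hk, if_neg (fun h => hk h.symm), zero_mul]
  rw [Finset.sum_congr rfl this, ← Finset.sum_filter]
  refine Finset.sum_congr ?_ fun _ _ => rfl
  ext c
  simp [and_comm]

/-- the graph of a parent function -/
def Gf (f : V → V) : SimpleGraph V where
  Adj u v := u ≠ v ∧ (f u = v ∨ f v = u)
  symm := ⟨fun _ _ h => ⟨h.1.symm, h.2.symm⟩⟩
  loopless := ⟨fun _ h => h.1 rfl⟩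

lemma reach_closed {G : SimpleGraph V} (D : V → Prop) (hD : ∀ a b, D a → G.Adj a b → D b)
    {u v : V} (h : G.Reachable u v) (hu : D u) : D v := by
  obtain ⟨p⟩ := h
  induction p with
  | nil => exact hu
  | cons hadj _ ih => exact ih (hD _ _ hu hadj)

lemma rank_iterate {f : V → V} {h : V → ℕ} (hh : ∀ v, f v ≠ v → h (f v) < h v) (k : ℕ) (v : V) :
    h (f^[k] v) ≤ h v := by
  induction k generalizing v with
  | zero => simp
  | succ k ih =>
    rw [Function.iterate_succ_apply]
    refine (ih _).trans ?_
    by_cases hv : f v = v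
    · rw [hv]
    · exact (hh v hv).le

lemma Gf_isAcyclic {f : V → V} (hf : Acyc f) : (Gf f).IsAcyclic := by
  obtain ⟨h, hh⟩ := hf
  rw [SimpleGraph.isAcyclic_iff_forall_adj_isBridge]
  have main : ∀ u, f u ≠ u → (Gf f).IsBridge s(u, f u) := by
    intro u hu
    rw [SimpleGraph.isBridge_iff]
    intro hr
    have := reach_closed (fun w => ∃ k : ℕ, f^[k] w = u) ?_ hr ⟨0, rfl⟩
    · obtain ⟨k, hk⟩ := this
      have h1 := rank_iterate hh k (f u)
      rw [hk] at h1
      exact absurd (hh u hu) (not_lt.2 h1)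
    · rintro a b ⟨k, hk⟩ hab
      rw [SimpleGraph.deleteEdges_adj] at hab
      obtain ⟨⟨hne, hab | hab⟩, he⟩ := hab
      · cases k with
        | zero =>
          exfalso
          simp only [Function.iterate_zero, id] at hk
          subst hk; subst hab
          exact he rfl
        | succ k => exact ⟨k, by rw [← hab, ← Function.iterate_succ_apply]; exact hk⟩
      · exact ⟨k + 1, by rw [Function.iterate_succ_apply, hab]; exact hk⟩
  rintro u v ⟨hne, huv | huv⟩
  · subst huv; exact main u hne.symm
  · subst huv; rw [Sym2.eq_swap]; exact main v hne

lemma Gf_reach_iterate (f : V → V) (k : ℕ) (v : V) : (Gf f).Reachable v (f^[k] v) := by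
  induction k generalizing v with
  | zero => exact SimpleGraph.Reachable.refl _
  | succ k ih =>
    rw [Function.iterate_succ_apply]
    by_cases hv : f v = v
    · rw [hv]; exact ih v
    · have : (Gf f).Adj v (f v) := ⟨Ne.symm hv, Or.inl rfl⟩
      exact this.reachable.trans (ih _)

lemma exists_root {f : V → V} (hf : Acyc f) (v : V) : ∃ r, f r = r ∧ (Gf f).Reachable v r := by
  obtain ⟨h, hh⟩ := hf
  induction hn : h v using Nat.strong_induction_on generalizing v with
  | _ n ih =>
  by_cases hv : f v = v
  · exact ⟨v, hv, SimpleGraph.Reachable.refl _⟩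
  · obtain ⟨r, hr, hr2⟩ := ih _ (hn ▸ hh v hv) (f v) rfl
    exact ⟨r, hr, (Gf_reach_iterate f 1 v).trans hr2⟩

lemma root_unique {f : V → V} {r s : V} (hr : f r = r) (hs : f s = s)
    (h : (Gf f).Reachable r s) : s = r := by
  have := reach_closed (fun w => ∃ k : ℕ, f^[k] w = r) ?_ h ⟨0, rfl⟩
  · obtain ⟨k, hk⟩ := this
    rwa [Function.iterate_fixed hs] at hk
  · rintro a b ⟨k, hk⟩ ⟨hne, hab | hab⟩
    · cases k with
      | zero =>
        simp only [Function.iterate_zero, id] at hk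
        subst hk; exact ⟨0, by rw [← hab]; exact hr⟩
      | succ k => exact ⟨k, by rw [← hab, ← Function.iterate_succ_apply]; exact hk⟩
    · exact ⟨k + 1, by rw [Function.iterate_succ_apply, hab]; exact hk⟩

lemma Gf_roots {f : V → V} (hf : Acyc f) (c : (Gf f).ConnectedComponent) :
    ∃! v, v ∈ (fx f : Set V) ∧ (Gf f).connectedComponentMk v = c := by
  induction c using SimpleGraph.ConnectedComponent.ind with
  | _ v =>
  obtain ⟨r, hr, hr2⟩ := exists_root hf v
  refine ⟨r, ⟨by simpa [fx] using hr, SimpleGraph.ConnectedComponent.sound hr2.symm⟩, ?_⟩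
  rintro s ⟨hs, hs2⟩
  have hs' : f s = s := by simpa [fx] using hs
  exact root_unique hr hs' ((SimpleGraph.ConnectedComponent.exact hs2).trans hr2).symm

lemma card_comp {G : SimpleGraph V} {R : Set V}
    (h : ∀ c : G.ConnectedComponent, ∃! v : V, v ∈ R ∧ G.connectedComponentMk v = c) :
    Nat.card G.ConnectedComponent = R.ncard := by
  rw [← Nat.card_coe_set_eq]
  symm
  refine Nat.card_eq_of_bijective (fun r : R => G.connectedComponentMk r) ⟨?_, ?_⟩
  · rintro ⟨a, ha⟩ ⟨b, hb⟩ hab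
    exact Subtype.ext ((h _).unique ⟨ha, hab⟩ ⟨hb, rfl⟩)
  · intro c
    obtain ⟨v, ⟨hv, hv2⟩, -⟩ := h c
    exact ⟨⟨v, hv⟩, hv2⟩

lemma Gf_degree {f : V → V} (hf : Acyc f) (v : V) :
    ((Gf f).neighborSet v).ncard = kids f v + if f v = v then 0 else 1 := by
  obtain ⟨h, hh⟩ := hf
  unfold kids
  by_cases hv : f v = v
  · have : (Gf f).neighborSet v = ((fx f)ᶜ.filter (fun u => f u = v) : Finset V) := by
      ext u
      simp only [SimpleGraph.mem_neighborSet, Gf, fx, Finset.coe_filter, mem_compl, mem_filter,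
        mem_univ, true_and, Set.mem_ofPred_eq, hv]
      constructor
      · rintro ⟨h1, h2 | h2⟩
        · exact absurd h2 h1
        · exact ⟨by rw [h2]; exact h1, h2⟩
      · rintro ⟨h1, h2⟩
        exact ⟨by rw [h2] at h1; exact h1, Or.inr h2⟩
    rw [this, Set.ncard_coe_finset]; simp [hv]
  · have : (Gf f).neighborSet v = (insert (f v) ((fx f)ᶜ.filter (fun u => f u = v)) : Finset V) := by
      ext u
      simp only [SimpleGraph.mem_neighborSet, Gf, fx, Finset.coe_filter, mem_compl, mem_filter,
        mem_univ, true_and, Set.mem_ofPred_eq, Finset.coe_insert, Set.mem_insert_iff]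
      constructor
      · rintro ⟨h1, h2 | h2⟩
        · exact Or.inl h2.symm
        · exact Or.inr ⟨by rw [h2]; exact h1, h2⟩
      · rintro (rfl | ⟨h1, h2⟩)
        · exact ⟨Ne.symm hv, Or.inl rfl⟩
        · exact ⟨by rw [h2] at h1; exact h1, Or.inr h2⟩
    rw [this, Set.ncard_coe_finset, Finset.card_insert_of_notMem]
    · simp [hv]
    · intro hm
      have h2 := (mem_filter.1 hm).2
      have h3 := hh v hv
      have h4 := hh (f v) (by rw [h2]; exact Ne.symm hv)
      rw [h2] at h4
      omega

lemma Gf_inj {f g : V → V} (hf : Acyc f) (hG : Gf f = Gf g)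
    (hR : fx f = fx g) : f = g := by
  obtain ⟨h, hh⟩ := hf
  have hR' : ∀ v, f v = v ↔ g v = v := by
    intro v
    have := Finset.ext_iff.1 hR v
    simpa [fx] using this
  have : ∀ n v, h v = n → f v = g v := by
    intro n
    induction n using Nat.strong_induction_on with
    | _ n ih =>
    intro v hn
    by_cases hv : f v = v
    · rw [hv, (hR' v).1 hv]
    · have hadj : (Gf f).Adj v (f v) := ⟨Ne.symm hv, Or.inl rfl⟩
      rw [hG] at hadj
      obtain ⟨-, h1 | h1⟩ := hadj
      · exact h1.symm
      · exfalso
        have h2 := hh v hv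
        have h3 := ih _ (hn ▸ h2) (f v) rfl
        rw [h1] at h3
        have h4 := hh (f v) (by rw [h3]; exact Ne.symm hv)
        rw [h3] at h4
        omega
  funext v; exact this _ v rfl

lemma Gf_surj {G : SimpleGraph V} {R : Set V} (hG : G.IsAcyclic)
    (hR : ∀ c : G.ConnectedComponent, ∃! v : V, v ∈ R ∧ G.connectedComponentMk v = c) :
    ∃ f : V → V, Acyc f ∧ Gf f = G ∧ (fx f : Set V) = R := by
  classical
  have hu : ∀ r s, r ∈ R → s ∈ R → G.Reachable r s → r = s := fun r s hr hs h =>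
    (hR _).unique ⟨hr, rfl⟩ ⟨hs, SimpleGraph.ConnectedComponent.sound h.symm⟩
  have he : ∀ v, ∃ r, r ∈ R ∧ G.Reachable v r := by
    intro v
    obtain ⟨r, ⟨h1, h2⟩, -⟩ := hR (G.connectedComponentMk v)
    exact ⟨r, h1, (SimpleGraph.ConnectedComponent.exact h2).symm⟩
  choose ρ hρ hρr using he
  have hstep : ∀ v, ∃ w, (v ∈ R → w = v) ∧
      (v ∉ R → G.Adj v w ∧ G.dist w (ρ w) < G.dist v (ρ v)) := by
    intro v
    by_cases hv : v ∈ R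
    · exact ⟨v, fun _ => rfl, fun h => absurd hv h⟩
    · have hne : v ≠ ρ v := fun h => hv (h ▸ hρ v)
      obtain ⟨p, hp⟩ := (hρr v).exists_walk_length_eq_dist
      obtain ⟨w, hadj, q, hq⟩ : ∃ w, G.Adj v w ∧ ∃ q : G.Walk w (ρ v), q.length < p.length := by
        generalize ρ v = r at *
        cases p with
        | nil => exact absurd rfl hne
        | cons hadj q => exact ⟨_, hadj, q, by simp⟩
      refine ⟨w, fun h => absurd h hv, fun _ => ⟨hadj, ?_⟩⟩
      have : ρ w = ρ v :=
        hu _ _ (hρ w) (hρ v) ((hρr w).symm.trans (hadj.symm.reachable.trans (hρr v)))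
      rw [this, ← hp]
      exact (SimpleGraph.dist_le q).trans_lt hq
  choose f hf1 hf2 using hstep
  have hfix : ∀ v, f v = v ↔ v ∈ R := by
    intro v
    refine ⟨fun h => ?_, hf1 v⟩
    by_contra hv
    exact (hf2 v hv).1.ne h.symm
  have hac : Acyc f := ⟨fun v => G.dist v (ρ v), fun v hv => (hf2 v (fun h => hv (hf1 v h))).2⟩
  have hle : ∀ a b, (Gf f).Adj a b → G.Adj a b := by
    rintro a b ⟨hne, rfl | rfl⟩
    · exact (hf2 a (fun h => hne (hf1 a h).symm)).1
    · exact (hf2 b (fun h => hne (hf1 b h))).1.symm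
  refine ⟨f, hac, ?_, ?_⟩
  · refine le_antisymm (fun a b h => hle a b h) ?_
    intro u v huv
    by_contra hn
    have hn' : ¬ (f u = v ∨ f v = u) := fun h => hn ⟨huv.ne, h⟩
    push Not at hn'
    have hb := (SimpleGraph.isAcyclic_iff_forall_adj_isBridge.1 hG) huv
    rw [SimpleGraph.isBridge_iff] at hb
    apply hb
    obtain ⟨r, hr, hr2⟩ := exists_root hac u
    obtain ⟨s, hs, hs2⟩ := exists_root hac v
    have hle' : Gf f ≤ G := fun a b h => hle a b h
    have hrs : r = s := hu r s ((hfix r).1 hr) ((hfix s).1 hs)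
      ((hr2.mono hle').symm.trans (huv.reachable.trans (hs2.mono hle')))
    subst hrs
    refine (hr2.trans hs2.symm).mono ?_
    intro a b hab
    rw [SimpleGraph.deleteEdges_adj]
    refine ⟨hle a b hab, ?_⟩
    intro he
    rw [Set.mem_singleton_iff, Sym2.eq_iff] at he
    rcases he with ⟨rfl, rfl⟩ | ⟨rfl, rfl⟩
    · exact hn hab
    · exact hn hab.symm
  · ext v; simp [fx, hfix]

open Classical in
lemma card_forests (Δ m : ℕ) (hΔ : 1 ≤ Δ) :
    Nat.card {p : SimpleGraph V × Set V //
        p.1.IsAcyclic ∧ Nat.card p.1.ConnectedComponent = m ∧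
        (∀ c : p.1.ConnectedComponent,
          ∃! v : V, v ∈ p.2 ∧ p.1.connectedComponentMk v = c) ∧
        (∀ v : V, (p.1.neighborSet v).ncard ≤ Δ) ∧
        (∀ v ∈ p.2, (p.1.neighborSet v).ncard ≤ Δ - 1)}
    = ((univ : Finset (V → V)).filter
      (fun f => (Acyc f ∧ (fx f).card = m) ∧ ∀ v, kids f v < Δ)).card := by
  have hdeg : ∀ f : V → V, Acyc f → (((∀ v : V, ((Gf f).neighborSet v).ncard ≤ Δ) ∧
        (∀ v ∈ (fx f : Set V), ((Gf f).neighborSet v).ncard ≤ Δ - 1)) ↔ ∀ v, kids f v < Δ) := by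
    intro f hf
    simp only [Gf_degree hf]
    constructor
    · rintro ⟨h1, h2⟩ v
      have h1 := h1 v
      have h2 := h2 v
      by_cases hv : f v = v
      · have := h2 (by simpa [fx] using hv)
        simp only [hv, if_true] at this
        omega
      · simp only [hv, if_false] at h1
        omega
    · intro h
      refine ⟨fun v => ?_, fun v hv => ?_⟩
      · have := h v
        split_ifs <;> omega
      · have hv' : f v = v := by simpa [fx] using hv
        have := h v
        simp only [hv', if_true]
        omega
  rw [← Nat.card_eq_finsetCard]
  symm
  refine Nat.card_eq_of_bijective (fun f => ⟨(Gf f.1, (fx f.1 : Set V)), ?_⟩) ⟨?_, ?_⟩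
  · obtain ⟨f, hf⟩ := f
    obtain ⟨⟨hf, hm⟩, hk⟩ := (mem_filter.1 hf).2
    refine ⟨Gf_isAcyclic hf, ?_, Gf_roots hf, (hdeg f hf).2 hk⟩
    rw [card_comp (Gf_roots hf), Set.ncard_coe_finset, hm]
  · rintro ⟨f, hf⟩ ⟨g, hg⟩ h
    have h' := congrArg Subtype.val h
    simp only [Prod.mk.injEq, Finset.coe_inj] at h'
    exact Subtype.ext (Gf_inj (mem_filter.1 hf).2.1.1 h'.1 h'.2)
  · rintro ⟨⟨G, R⟩, h1, h2, h3, h4⟩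
    simp only at h1 h2 h3 h4
    obtain ⟨f, hf, rfl, rfl⟩ := Gf_surj h1 h3
    refine ⟨⟨f, mem_filter.2 ⟨mem_univ _, ⟨hf, ?_⟩, (hdeg f hf).1 h4⟩⟩, rfl⟩
    rw [card_comp h3, Set.ncard_coe_finset] at h2
    exact h2

end Forests

/-- The number of labelled rooted forests on `[n]` with maximum degree at most `Δ`,
exactly `m` components, and every root of degree at most `Δ−1`, equals
`((n−1)!/(m−1)!)·[xⁿ] xᵐ (γ_Δ(x))ⁿ`. Rooted forests are encoded as pairs `(G, R)` of
an acyclic graph and a set of roots meeting every component exactly once. -/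
theorem count_bounded_degree_rooted_forests (n Δ m : ℕ)
    (hn : 2 ≤ n) (hΔ : 3 ≤ Δ) (hm1 : 1 ≤ m) (hm : m ≤ n - 1) :
    (Nat.card {p : SimpleGraph (Fin n) × Set (Fin n) //
        p.1.IsAcyclic ∧ Nat.card p.1.ConnectedComponent = m ∧
        (∀ c : p.1.ConnectedComponent,
          ∃! v : Fin n, v ∈ p.2 ∧ p.1.connectedComponentMk v = c) ∧
        (∀ v : Fin n, (p.1.neighborSet v).ncard ≤ Δ) ∧
        (∀ v ∈ p.2, (p.1.neighborSet v).ncard ≤ Δ - 1)} : ℚ)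
      = (Nat.factorial (n - 1) : ℚ) / (Nat.factorial (m - 1) : ℚ)
          * ((Polynomial.X ^ m * gamPoly Δ ^ n).coeff n) := by
  have hc : Fintype.card (Fin n) = n := Fintype.card_fin n
  rw [card_forests Δ m (by omega), card_functions Δ m hm1 (by rw [hc]; omega), hc,
    ← coeff_gam Δ (n - m) n hc]
  have h1 : (Polynomial.X ^ m * gamPoly Δ ^ n).coeff n = (gamPoly Δ ^ n).coeff (n - m) := by
    have : n = (n - m) + m := by omega
    conv_lhs => rw [Polynomial.coeff_X_pow_mul', if_pos (by omega)]
  rw [h1, Nat.cast_choose ℚ (show m - 1 ≤ n - 1 by omega),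
    show n - 1 - (m - 1) = n - m by omega]
  have h2 : ((m - 1).factorial : ℚ) ≠ 0 := by positivity
  have h3 : ((n - m).factorial : ℚ) ≠ 0 := by positivity
  field_simp
end
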